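/- arXiv:1912.08318 — 3 statements merged into one kernel-verified Lean document; each statement's English description precedes it below -/
import Mathlib

section
/- Let n ≥ 1 and let C be a subset of {1,…,2n}. Then C is a circuit of the trivial unit interval positroid P_n if and only if either C = {1,…,n} ∪ {j} for some j with n+1 ≤ j ≤ 2n, or C = {i, j} for some i, j with n+1 ≤ i < j ≤ 2n. -/
/-- Column `j` (1-indexed, `1 ≤ j ≤ 2n`) of the `n × 2n` matrix `M(n)`: the first `n`
columns form the identity matrix, and each of the last `n` columns has `i`-th entry
`(-1)^(n-i)` (1-indexed rows, realized here with 0-indexed `Fin n`). -/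
def uipCol (n : ℕ) (j : ℕ) : Fin n → ℚ :=
  fun i => if j ≤ n then (if (i : ℕ) + 1 = j then 1 else 0)
           else (-1 : ℚ) ^ (n - 1 - (i : ℕ))

/-- Independent sets of the trivial unit interval positroid `P_n`: subsets of the ground
set `{1, …, 2n}` indexing linearly independent columns of `M(n)`. -/
def uipIndep (n : ℕ) (S : Finset ℕ) : Prop :=
  S ⊆ Finset.Icc 1 (2 * n) ∧
    LinearIndependent ℚ (fun j : {x // x ∈ S} => uipCol n j.1)

/-- Bases of `P_n`: independent sets of size `n`. -/
def uipBasis (n : ℕ) (B : Finset ℕ) : Prop :=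
  uipIndep n B ∧ B.card = n

/-- Circuits of `P_n`: minimal dependent subsets of the ground set. -/
def uipCircuit (n : ℕ) (C : Finset ℕ) : Prop :=
  C ⊆ Finset.Icc 1 (2 * n) ∧ ¬ uipIndep n C ∧ ∀ D ⊂ C, uipIndep n D

/-- `e` is active with respect to `A` in `P_n`: there is a circuit `C` with
`e ∈ C ⊆ A ∪ {e}` and `e = min C`. -/
def uipActive (n : ℕ) (A : Finset ℕ) (e : ℕ) : Prop :=
  ∃ C : Finset ℕ, uipCircuit n C ∧ e ∈ C ∧ C ⊆ insert e A ∧ ∀ x ∈ C, e ≤ x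

/-- The external set `Ext(A)`: active elements with respect to `A` not belonging to `A`. -/
def uipExt (n : ℕ) (A : Finset ℕ) : Set ℕ :=
  {e | uipActive n A e ∧ e ∉ A}

/-- The external order on bases: `A ≤_Ext B` iff `A ⊆ B ∪ Ext(B)`. -/
def uipExtLe (n : ℕ) (A B : Finset ℕ) : Prop :=
  (A : Set ℕ) ⊆ (B : Set ℕ) ∪ uipExt n B

/-- The family of sets claimed to be the circuits of `P_n`. -/
def uipCircuitFamily (n : ℕ) (C : Finset ℕ) : Prop :=
  (∃ j, n + 1 ≤ j ∧ j ≤ 2 * n ∧ C = insert j (Finset.Icc 1 n)) ∨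
    (∃ i j, n + 1 ≤ i ∧ i < j ∧ j ≤ 2 * n ∧ C = {i, j})

theorem uipCol_of_lt {n j : ℕ} (h : n < j) (i : Fin n) :
    uipCol n j i = (-1 : ℚ) ^ (n - 1 - (i : ℕ)) := by
  simp [uipCol, Nat.not_le.mpr h]

theorem sum_smul_uipCol_apply (n : ℕ) (S : Finset ℕ) (f : ℕ → ℚ) (i : Fin n) :
    (∑ j ∈ S, f j • uipCol n j) i =
      (if (i : ℕ) + 1 ∈ S then f (i + 1) else 0) +
        (-1 : ℚ) ^ (n - 1 - (i : ℕ)) * ∑ j ∈ S with n < j, f j := by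
  have h : ∀ j ∈ S, f j * uipCol n j i =
      (if (i : ℕ) + 1 = j then f j else 0) +
        (if n < j then (-1 : ℚ) ^ (n - 1 - (i : ℕ)) * f j else 0) := by
    intro j _
    have hi := i.isLt
    by_cases hj : n < j
    · have hij : (i : ℕ) + 1 ≠ j := by omega
      simp [uipCol_of_lt hj, hj, hij, mul_comm]
    · simp [uipCol, hj, Nat.not_lt.mp hj]
  simp only [Finset.sum_apply, Pi.smul_apply, smul_eq_mul]
  rw [Finset.sum_congr rfl h, Finset.sum_add_distrib, Finset.sum_ite_eq, Finset.mul_sum,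
    Finset.sum_filter]

theorem not_linearIndepOn_of_uipCircuitFamily {n : ℕ} {D : Finset ℕ}
    (hD : uipCircuitFamily n D) : ¬ LinearIndepOn ℚ (uipCol n) (D : Set ℕ) := by
  intro h
  rcases hD with ⟨j, hj, -, rfl⟩ | ⟨i, j, hi, hij, -, rfl⟩
  · rw [linearIndepOn_finset_iff] at h
    have hfilter : {x ∈ insert j (Finset.Icc 1 n) | n < x} = {j} := by
      ext x
      simp only [Finset.mem_filter, Finset.mem_insert, Finset.mem_Icc, Finset.mem_singleton]
      omega
    have := h (fun k => if k = j then -1 else (-1) ^ (n - k)) (by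
      ext i
      have hi := i.isLt
      have hmem : (i : ℕ) + 1 ∈ insert j (Finset.Icc 1 n) := by simp
      have hne : (i : ℕ) + 1 ≠ j := by omega
      have hexp : n - ((i : ℕ) + 1) = n - 1 - i := by omega
      rw [sum_smul_uipCol_apply, hfilter, if_pos hmem]
      simp [hne, hexp]) j (by simp)
    simp at this
  · refine hij.ne (h.injOn (by simp) (by simp) ?_)
    ext k
    rw [uipCol_of_lt (by omega), uipCol_of_lt (by omega)]

theorem linearIndepOn_of_forall_not_uipCircuitFamily {n : ℕ} {S : Finset ℕ}
    (hS : S ⊆ Finset.Icc 1 (2 * n)) (h : ∀ D ⊆ S, ¬ uipCircuitFamily n D) :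
    LinearIndepOn ℚ (uipCol n) (S : Set ℕ) := by
  rw [linearIndepOn_finset_iff]
  intro f hf
  have hcoord (i : Fin n) := (sum_smul_uipCol_apply n S f i).symm.trans (congrFun hf i)
  have hlarge : ∀ j ∈ S, n < j → {x ∈ S | n < x} = {j} := by
    intro j hj hnj
    ext x
    simp only [Finset.mem_filter, Finset.mem_singleton]
    refine ⟨fun ⟨hx, hnx⟩ => ?_, fun hx => hx ▸ ⟨hj, hnj⟩⟩
    have hx2 := (Finset.mem_Icc.mp (hS hx)).2
    have hj2 := (Finset.mem_Icc.mp (hS hj)).2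
    rcases lt_trichotomy x j with hlt | heq | hlt
    · exact (h {x, j} (by simp [Finset.insert_subset_iff, hx, hj])
        (Or.inr ⟨x, j, hnx, hlt, hj2, rfl⟩)).elim
    · exact heq
    · exact (h {j, x} (by simp [Finset.insert_subset_iff, hx, hj])
        (Or.inr ⟨j, x, hnj, hlt, hx2, rfl⟩)).elim
  have hzero : ∀ j ∈ S, n < j → f j = 0 := by
    intro j hj hnj
    have hmiss : ¬ Finset.Icc 1 n ⊆ S := fun hsub =>
      h _ (Finset.insert_subset hj hsub)
        (Or.inl ⟨j, hnj, (Finset.mem_Icc.mp (hS hj)).2, rfl⟩)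
    obtain ⟨m, hm, hmS⟩ := Finset.not_subset.mp hmiss
    rw [Finset.mem_Icc] at hm
    have hc := hcoord ⟨m - 1, by omega⟩
    simpa [Nat.sub_add_cancel hm.1, hmS, hlarge j hj hnj] using hc
  have hsum : ∑ j ∈ S with n < j, f j = 0 :=
    Finset.sum_eq_zero fun j hj => hzero j (Finset.mem_filter.mp hj).1 (Finset.mem_filter.mp hj).2
  intro k hk
  by_cases hnk : n < k
  · exact hzero k hk hnk
  · have hk1 := (Finset.mem_Icc.mp (hS hk)).1
    have hc := hcoord ⟨k - 1, by omega⟩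
    simpa [Nat.sub_add_cancel hk1, hk, hsum] using hc

theorem uipIndep_iff {n : ℕ} {S : Finset ℕ} (hS : S ⊆ Finset.Icc 1 (2 * n)) :
    uipIndep n S ↔ ∀ D ⊆ S, ¬ uipCircuitFamily n D :=
  ⟨fun h _ hD hF => not_linearIndepOn_of_uipCircuitFamily hF
      (LinearIndepOn.mono (show LinearIndepOn ℚ (uipCol n) (S : Set ℕ) from h.2)
        (Finset.coe_subset.mpr hD)),
    fun h => ⟨hS, linearIndepOn_of_forall_not_uipCircuitFamily hS h⟩⟩

theorem uipCircuitFamily.eq_of_subset {n : ℕ} (hn : 1 ≤ n) {C D : Finset ℕ}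
    (hC : uipCircuitFamily n C) (hD : uipCircuitFamily n D) (h : D ⊆ C) : D = C := by
  have hcard : ∀ j, n + 1 ≤ j → (insert j (Finset.Icc 1 n)).card = n + 1 := by
    intro j hj
    rw [Finset.card_insert_of_notMem (by simp; omega), Nat.card_Icc, Nat.add_sub_cancel]
  refine Finset.eq_of_subset_of_card_le h ?_
  rcases hC with ⟨j, hj, -, rfl⟩ | ⟨i, j, hi, hij, -, rfl⟩ <;>
    rcases hD with ⟨j', hj', -, rfl⟩ | ⟨i', j', hi', hij', -, rfl⟩
  · rw [hcard j hj, hcard j' hj']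
  · have h1 := h (Finset.mem_insert_self i' {j'})
    have h2 := h (Finset.mem_insert_of_mem (Finset.mem_singleton_self j'))
    simp only [Finset.mem_insert, Finset.mem_Icc] at h1 h2
    omega
  · rw [hcard j' hj', Finset.card_pair hij.ne]
    omega
  · rw [Finset.card_pair hij.ne, Finset.card_pair hij'.ne]

/-- A subset C of {1,…,2n} is a circuit of P_n iff C = {1,…,n} ∪ {j} for some
n+1 ≤ j ≤ 2n, or C = {i, j} for some n+1 ≤ i < j ≤ 2n. -/
theorem uip_circuit_characterization (n : ℕ) (hn : 1 ≤ n) (C : Finset ℕ)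
    (hC : C ⊆ Finset.Icc 1 (2 * n)) :
    uipCircuit n C ↔
      (∃ j, n + 1 ≤ j ∧ j ≤ 2 * n ∧ C = insert j (Finset.Icc 1 n)) ∨
        (∃ i j, n + 1 ≤ i ∧ i < j ∧ j ≤ 2 * n ∧ C = {i, j}) := by
  change uipCircuit n C ↔ uipCircuitFamily n C
  constructor
  · rintro ⟨-, hdep, hmin⟩
    rw [uipIndep_iff hC] at hdep
    push Not at hdep
    obtain ⟨D, hDC, hD⟩ := hdep
    rcases hDC.eq_or_ssubset with rfl | hss
    · exact hD
    · exact ((uipIndep_iff (hDC.trans hC)).mp (hmin D hss) D subset_rfl hD).elim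
  · intro hF
    refine ⟨hC, fun hI => (uipIndep_iff hC).mp hI C subset_rfl hF, fun D hD => ?_⟩
    rw [uipIndep_iff (hD.subset.trans hC)]
    intro E hED hE
    exact (hED.trans_ssubset hD).ne (hF.eq_of_subset hn hE (hED.trans hD.subset))
end

section
/- Let m ≥ 1 and let B be a basis of the trivial unit interval positroid P_m with 2m−1 ∈ B. Then B' = (B \ {2m−1}) ∪ {2m} is also a basis of P_m, and Ext(B') = Ext(B) ∪ {2m−1}. -/
theorem uipCol_two_mul_sub_one (m : ℕ) (hm : 1 ≤ m) :
    uipCol m (2 * m - 1) = uipCol m (2 * m) := by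
  funext i
  unfold uipCol
  rcases hm.eq_or_lt with rfl | hm
  · simp
  · rw [if_neg (by omega), if_neg (by omega)]

theorem uipCol_two_mul_ne_zero (m : ℕ) (hm : 1 ≤ m) : uipCol m (2 * m) ≠ 0 := by
  intro h
  have h0 := congrFun h ⟨m - 1, by omega⟩
  simp [uipCol, show ¬ 2 * m ≤ m by omega] at h0

theorem uipIndep.subset {n : ℕ} {S T : Finset ℕ} (hT : uipIndep n T) (h : S ⊆ T) :
    uipIndep n S :=
  ⟨h.trans hT.1, hT.2.comp (fun x : {x // x ∈ S} => (⟨x.1, h x.2⟩ : {x // x ∈ T}))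
    fun _ _ hxy => Subtype.ext (congrArg (fun z => z.1) hxy)⟩

theorem uipIndep_singleton {n j : ℕ} (hj : j ∈ Finset.Icc 1 (2 * n)) (h : uipCol n j ≠ 0) :
    uipIndep n {j} := by
  refine ⟨Finset.singleton_subset_iff.2 hj, ?_⟩
  have : Unique {x // x ∈ ({j} : Finset ℕ)} :=
    ⟨⟨⟨j, Finset.mem_singleton_self j⟩⟩, fun x => Subtype.ext (Finset.mem_singleton.1 x.2)⟩
  rw [linearIndependent_unique_iff]
  rwa [Finset.mem_singleton.1 (Subtype.prop default)]

theorem not_uipIndep_of_uipCol_eq {n i j : ℕ} {S : Finset ℕ} (hi : i ∈ S) (hj : j ∈ S)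
    (hij : i ≠ j) (h : uipCol n i = uipCol n j) : ¬ uipIndep n S := fun hS =>
  hij (congrArg Subtype.val (hS.2.injective (a₁ := ⟨i, hi⟩) (a₂ := ⟨j, hj⟩) h))

/-- Two equal nonzero columns form a circuit. -/
theorem uipCircuit_pair {n i j : ℕ} (hi : i ∈ Finset.Icc 1 (2 * n))
    (hj : j ∈ Finset.Icc 1 (2 * n)) (hij : i ≠ j) (h : uipCol n i = uipCol n j)
    (h0 : uipCol n j ≠ 0) : uipCircuit n {i, j} := by
  refine ⟨by simp [Finset.insert_subset_iff, hi, hj, -Finset.mem_Icc],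
    not_uipIndep_of_uipCol_eq (by simp) (by simp) hij h, fun D hD => ?_⟩
  obtain ⟨x, hx, hxD⟩ := Finset.exists_of_ssubset hD
  rcases (by simpa using hx : x = i ∨ x = j) with rfl | rfl
  · refine (uipIndep_singleton hj h0).subset fun y hy => ?_
    have := hD.1 hy
    grind
  · refine (uipIndep_singleton hi (h ▸ h0)).subset fun y hy => ?_
    have := hD.1 hy
    grind

section Swap

variable {n i j : ℕ}

theorem uipIndep.map_swap (hi : i ∈ Finset.Icc 1 (2 * n)) (hj : j ∈ Finset.Icc 1 (2 * n))
    (h : uipCol n i = uipCol n j) {S : Finset ℕ} (hS : uipIndep n S) :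
    uipIndep n (S.map (Equiv.swap i j).toEmbedding) := by
  refine ⟨fun x hx => ?_, ?_⟩
  · have := hS.1 (Finset.mem_map_equiv.1 hx)
    rw [Equiv.symm_swap, Equiv.swap_apply_def] at this
    grind
  · have hcol : ∀ x, uipCol n (Equiv.swap i j x) = uipCol n x := fun x => by
      rw [Equiv.swap_apply_def]
      grind
    have hli := hS.2.comp
      (fun x : {x // x ∈ S.map (Equiv.swap i j).toEmbedding} =>
        (⟨Equiv.swap i j x.1, by simpa using Finset.mem_map_equiv.1 x.2⟩ : {x // x ∈ S}))
      fun x y hxy => Subtype.ext ((Equiv.swap i j).injective (congrArg (fun z => z.1) hxy))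
    convert hli using 2 with x
    exact (hcol x.1).symm

theorem Finset.map_swap_map_swap {α : Type*} [DecidableEq α] (i j : α) (S : Finset α) :
    (S.map (Equiv.swap i j).toEmbedding).map (Equiv.swap i j).toEmbedding = S := by
  ext x
  simp [Finset.mem_map_equiv]

theorem uipCircuit.map_swap (hi : i ∈ Finset.Icc 1 (2 * n)) (hj : j ∈ Finset.Icc 1 (2 * n))
    (h : uipCol n i = uipCol n j) {C : Finset ℕ} (hC : uipCircuit n C) :
    uipCircuit n (C.map (Equiv.swap i j).toEmbedding) := by
  refine ⟨fun x hx => ?_, fun hI => hC.2.1 ?_, fun D hD => ?_⟩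
  · have := hC.1 (Finset.mem_map_equiv.1 hx)
    rw [Equiv.symm_swap, Equiv.swap_apply_def] at this
    grind
  · rw [← Finset.map_swap_map_swap i j C]
    exact hI.map_swap hi hj h
  · rw [← Finset.map_swap_map_swap i j D]
    refine (hC.2.2 _ ?_).map_swap hi hj h
    rw [← Finset.map_swap_map_swap i j C]
    exact Finset.map_ssubset_map.2 hD

end Swap

theorem uipActive.map_swap {m e : ℕ} (hm : 1 ≤ m) {A : Finset ℕ} (he₁ : e ≠ 2 * m - 1)
    (he₂ : e ≠ 2 * m) (hA : uipActive m A e) :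
    uipActive m (A.map (Equiv.swap (2 * m - 1) (2 * m)).toEmbedding) e := by
  obtain ⟨C, hC, heC, hCA, hmin⟩ := hA
  have hle := (Finset.mem_Icc.1 (hC.1 heC)).2
  have hfix : Equiv.swap (2 * m - 1) (2 * m) e = e := Equiv.swap_apply_of_ne_of_ne he₁ he₂
  refine ⟨C.map (Equiv.swap (2 * m - 1) (2 * m)).toEmbedding,
    hC.map_swap (by simp; omega) (by simp; omega) (uipCol_two_mul_sub_one m hm),
    ?_, fun x hx => ?_, fun x hx => ?_⟩
  · simpa [Finset.mem_map_equiv, hfix] using heC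
  · rw [Finset.mem_map_equiv, Equiv.symm_swap] at hx
    rw [Finset.mem_insert, Finset.mem_map_equiv, Equiv.symm_swap]
    exact (Finset.mem_insert.1 (hCA hx)).imp_left fun h =>
      (Equiv.swap (2 * m - 1) (2 * m)).injective (h.trans hfix.symm)
  · rw [Finset.mem_map_equiv, Equiv.symm_swap] at hx
    have := hmin _ hx
    rw [Equiv.swap_apply_def] at this
    split_ifs at this <;> omega

theorem not_uipActive_two_mul {m : ℕ} (hm : 1 ≤ m) (A : Finset ℕ) :
    ¬ uipActive m A (2 * m) := by
  rintro ⟨C, hC, -, -, hmin⟩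
  refine hC.2.1 ((uipIndep_singleton (by simp; omega) (uipCol_two_mul_ne_zero m hm)).subset
    fun x hx => ?_)
  rw [Finset.mem_singleton]
  exact le_antisymm (Finset.mem_Icc.1 (hC.1 hx)).2 (hmin x hx)

/-- If B is a basis of P_m with 2m-1 ∈ B, then B' = (B \ {2m-1}) ∪ {2m} is a basis of
P_m and Ext(B') = Ext(B) ∪ {2m-1}. -/
theorem uip_build_up (m : ℕ) (hm : 1 ≤ m) (B : Finset ℕ) (hB : uipBasis m B)
    (hmem : 2 * m - 1 ∈ B) :
    uipBasis m (insert (2 * m) (B.erase (2 * m - 1))) ∧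
      uipExt m (insert (2 * m) (B.erase (2 * m - 1))) = uipExt m B ∪ {2 * m - 1} := by
  have hi : 2 * m - 1 ∈ Finset.Icc 1 (2 * m) := by simp; omega
  have hj : 2 * m ∈ Finset.Icc 1 (2 * m) := by simp; omega
  have hne : 2 * m - 1 ≠ 2 * m := by omega
  have hcol := uipCol_two_mul_sub_one m hm
  have hnot : 2 * m ∉ B := fun h => not_uipIndep_of_uipCol_eq hmem h hne hcol hB.1
  have hswap : insert (2 * m) (B.erase (2 * m - 1)) =
      B.map (Equiv.swap (2 * m - 1) (2 * m)).toEmbedding := by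
    ext x
    rw [Finset.mem_map_equiv, Equiv.symm_swap, Equiv.swap_apply_def]
    grind
  refine ⟨hswap ▸ ⟨hB.1.map_swap hi hj hcol, by rw [Finset.card_map, hB.2]⟩, ?_⟩
  ext e
  constructor
  · rintro ⟨hact, hmem'⟩
    by_cases he : e = 2 * m - 1
    · exact Or.inr he
    · have he₂ : e ≠ 2 * m := by grind
      rw [hswap] at hact
      have := hact.map_swap hm he he₂
      rw [Finset.map_swap_map_swap] at this
      exact Or.inl ⟨this, by grind⟩
  · rintro (⟨hact, hmem'⟩ | rfl)
    · have he₂ : e ≠ 2 * m := by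
        rintro rfl
        exact not_uipActive_two_mul hm B hact
      refine ⟨?_, by grind⟩
      rw [hswap]
      exact hact.map_swap hm (by grind) he₂
    · refine ⟨⟨_, uipCircuit_pair hi hj hne hcol (uipCol_two_mul_ne_zero m hm), by simp,
        fun x hx => ?_, fun x hx => ?_⟩, by grind⟩
      · grind
      · rcases (by simpa using hx : x = 2 * m - 1 ∨ x = 2 * m) with rfl | rfl <;> omega
end

section
/- Let m ≥ 1 and let B be a basis of the trivial unit interval positroid P_m with min B = 2. Then B' = (B \ {2}) ∪ {1} is also a basis of P_m, and Ext(B') = Ext(B) \ {1}. -/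
theorem uipIndep_iff_s11 (n : ℕ) (S : Finset ℕ) :
    uipIndep n S ↔ S ⊆ Finset.Icc 1 (2 * n) ∧ LinearIndepOn ℚ (uipCol n) (S : Set ℕ) :=
  Iff.rfl

theorem uipIndep.mono {n : ℕ} {S T : Finset ℕ} (hT : uipIndep n T) (hST : S ⊆ T) :
    uipIndep n S := by
  rw [uipIndep_iff_s11] at hT ⊢
  exact ⟨hST.trans hT.1, hT.2.mono (by exact_mod_cast hST)⟩

/-- The sum of the first two rows of the matrix vanishes on the columns `3, …, 2n` but not on the
first column. -/
theorem uipCol_one_notMem_span {n : ℕ} {S : Finset ℕ} (hn : 1 ≤ n)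
    (hS : S ⊆ Finset.Icc 3 (2 * n)) :
    uipCol n 1 ∉ Submodule.span ℚ (uipCol n '' (S : Set ℕ)) := by
  obtain rfl | hn2 : n = 1 ∨ 2 ≤ n := by omega
  · have hS' : S = ∅ := Finset.subset_empty.mp (hS.trans (by simp))
    subst hS'
    intro h
    have h0 : uipCol 1 1 = 0 := by simpa using h
    simpa [uipCol] using congrFun h0 0
  · obtain ⟨k, rfl⟩ := Nat.exists_eq_add_of_le' hn2
    let φ : (Fin (k + 2) → ℚ) →ₗ[ℚ] ℚ :=
      LinearMap.proj (R := ℚ) (φ := fun _ => ℚ) (0 : Fin (k + 2)) +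
        LinearMap.proj (R := ℚ) (φ := fun _ => ℚ) (1 : Fin (k + 2))
    have hle : Submodule.span ℚ (uipCol (k + 2) '' (S : Set ℕ)) ≤ LinearMap.ker φ := by
      rw [Submodule.span_le]
      rintro _ ⟨j, hj, rfl⟩
      have hj3 := (Finset.mem_Icc.mp (hS hj)).1
      have h1 : (1 : ℕ) ≠ j := by omega
      have h2 : (2 : ℕ) ≠ j := by omega
      by_cases hjk : j ≤ k + 2
      · simp [φ, uipCol, hjk, h1, h2]
      · simp [φ, uipCol, hjk, pow_succ]
    intro h
    simpa [φ, uipCol] using LinearMap.mem_ker.mp (hle h)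

/-- If B is a basis of P_m with min B = 2, then B' = (B \ {2}) ∪ {1} is a basis of
P_m and Ext(B') = Ext(B) \ {1}. -/
theorem uip_grow_spine (m : ℕ) (hm : 1 ≤ m) (B : Finset ℕ) (hB : uipBasis m B)
    (hmin : B.min = (2 : ℕ)) :
    uipBasis m (insert 1 (B.erase 2)) ∧
      uipExt m (insert 1 (B.erase 2)) = uipExt m B \ {1} := by
  have h2 : 2 ∈ B := Finset.mem_of_min hmin
  have hle : ∀ x ∈ B, 2 ≤ x := fun x hx => Finset.min_le_of_eq hx hmin
  have h1 : 1 ∉ B := fun h => by simpa using hle 1 h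
  refine ⟨⟨?_, ?_⟩, ?_⟩
  · have hI := hB.1.mono (B.erase_subset 2)
    rw [uipIndep_iff_s11] at hI ⊢
    refine ⟨Finset.insert_subset (Finset.mem_Icc.mpr (by omega)) hI.1, ?_⟩
    rw [Finset.coe_insert]
    refine hI.2.insert (uipCol_one_notMem_span hm fun x hx => ?_)
    have hx1 := Finset.mem_Icc.mp (hI.1 hx)
    obtain ⟨hx2, hxB⟩ := Finset.mem_erase.mp hx
    have := hle x hxB
    exact Finset.mem_Icc.mpr (by omega)
  · rw [Finset.card_insert_of_notMem (by simp [h1]), Finset.card_erase_add_one h2, hB.2]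
  · ext e
    simp only [uipExt, Set.mem_ofPred_eq, Set.mem_sdiff, Set.mem_singleton_iff]
    constructor
    · rintro ⟨⟨C, hC, heC, hCB, hCe⟩, heB⟩
      have he1 : e ≠ 1 := by rintro rfl; simp at heB
      have he0 := (Finset.mem_Icc.mp (hC.1 heC)).1
      have hsub : C ⊆ insert e B := fun x hx => by
        have := hCe x hx
        have := hCB hx
        grind
      have he2 : e ≠ 2 := by
        rintro rfl
        rw [Finset.insert_eq_of_mem h2] at hsub
        exact hC.2.1 (hB.1.mono hsub)
      exact ⟨⟨⟨C, hC, heC, hsub, hCe⟩, by grind⟩, he1⟩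
    · rintro ⟨⟨⟨C, hC, heC, hCB, hCe⟩, heB⟩, he1⟩
      have he0 := (Finset.mem_Icc.mp (hC.1 heC)).1
      have he2 : e ≠ 2 := by rintro rfl; exact heB h2
      refine ⟨⟨C, hC, heC, fun x hx => ?_, hCe⟩, by grind⟩
      have := hCe x hx
      have := hCB hx
      grind
end
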